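/- arXiv:2309.15760 — 4 statements merged into one kernel-verified Lean document; each statement's English description precedes it below -/
import Mathlib

section
/- Let F_1, ..., F_J be production functions on ℝ_+^N and let F(x) = max { Σ_{j=1}^J F_j(x_j) : x_j ≥ 0 for all j, Σ_{j=1}^J x_j = x } be the aggregate production function. Then F is upper semicontinuous on ℝ_+^N (and hence is itself a production function). -/
/-- `G` is the aggregate production function `⊕ⱼ F j` of the production functions `F j`:
for every `x ≥ 0`, `G x` is the maximum of `∑ⱼ F j (xs j)` over all allocations
`xs` with `xs j ≥ 0` and `∑ⱼ xs j = x`. -/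
def IsAggregate {N J : ℕ} (F : Fin J → (Fin N → ℝ) → ℝ) (G : (Fin N → ℝ) → ℝ) : Prop :=
  ∀ x : Fin N → ℝ, 0 ≤ x →
    IsGreatest {s : ℝ | ∃ xs : Fin J → (Fin N → ℝ),
      (∀ j, 0 ≤ xs j) ∧ (∑ j, xs j) = x ∧ s = ∑ j, F j (xs j)} (G x)

/-- The aggregate production function of production functions (usc and
nonnegative on the nonnegative orthant) is upper semicontinuous on the orthant. -/
theorem aggregate_production_function_usc
    {N J : ℕ} (F : Fin J → (Fin N → ℝ) → ℝ)
    (hF_nonneg : ∀ j, ∀ x : Fin N → ℝ, 0 ≤ x → 0 ≤ F j x)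
    (hF_usc : ∀ j, UpperSemicontinuousOn (F j) {x : Fin N → ℝ | 0 ≤ x})
    (G : (Fin N → ℝ) → ℝ) (hG : IsAggregate F G) :
    UpperSemicontinuousOn G {x : Fin N → ℝ | 0 ≤ x} := by
  intro x hx y hy
  by_contra hcon
  have hsum : UpperSemicontinuousOn
      (fun xs : Fin J → Fin N → ℝ => ∑ j, F j (xs j)) {xs | ∀ j, 0 ≤ xs j} :=
    upperSemicontinuousOn_sum fun j _ =>
      (hF_usc j).comp (continuous_apply j).continuousOn fun _ hxs => hxs j
  choose! a ha_nonneg ha_sum ha_val using fun x' (hx' : 0 ≤ x') => (hG x' hx').1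
  have : (nhdsWithin x {x | 0 ≤ x} ⊓ Filter.principal {x' | ¬ G x' < y}).NeBot :=
    Filter.frequently_mem_iff_neBot.mp (Filter.not_eventually.mp hcon)
  obtain ⟨U, hU_inf⟩ := Filter.exists_ultrafilter_le
    (nhdsWithin x {x | 0 ≤ x} ⊓ Filter.principal {x' | ¬ G x' < y})
  obtain ⟨hU, hU_principal⟩ := le_inf_iff.mp hU_inf
  have hUy : ∀ᶠ x' in (U : Filter (Fin N → ℝ)), ¬ G x' < y :=
    Filter.le_principal_iff.mp hU_principal
  have hU_mem : ∀ᶠ x' in (U : Filter (Fin N → ℝ)), 0 ≤ x' :=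
    hU self_mem_nhdsWithin
  have hU_lim : Filter.Tendsto id (U : Filter (Fin N → ℝ)) (nhds x) :=
    hU.trans nhdsWithin_le_nhds
  have hU_le : ∀ᶠ x' in (U : Filter (Fin N → ℝ)), x' ≤ x + 1 := by
    have hcoord : ∀ᶠ x' in nhds x, ∀ i, x' i < x i + 1 :=
      Filter.eventually_all.mpr fun i =>
        (continuous_apply i).continuousAt.eventually_lt_const (lt_add_one (x i))
    exact (hU_lim.eventually hcoord).mono fun x' h i => (h i).le
  have hcompact : IsCompact (Set.Icc (0 : Fin J → Fin N → ℝ) fun _ => x + 1) := isCompact_Icc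
  have ha_mem : ∀ᶠ x' in (U : Filter (Fin N → ℝ)),
      a x' ∈ Set.Icc (0 : Fin J → Fin N → ℝ) fun _ => x + 1 := by
    filter_upwards [hU_mem, hU_le] with x' h0 h1
    refine ⟨ha_nonneg x' h0, fun j => le_trans ?_ h1⟩
    calc a x' j ≤ ∑ k, a x' k :=
          Finset.single_le_sum (fun k _ => ha_nonneg x' h0 k) (Finset.mem_univ j)
      _ = x' := ha_sum x' h0
  obtain ⟨z, hz, haz⟩ := hcompact.ultrafilter_le_nhds' (U.map a) ha_mem
  have hz_lim : Filter.Tendsto a (U : Filter (Fin N → ℝ)) (nhds z) := haz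
  have hz_sum : ∑ j, z j = x := by
    have hcont : Continuous fun xs : Fin J → Fin N → ℝ => ∑ j, xs j := by fun_prop
    refine tendsto_nhds_unique ((hcont.tendsto z).comp hz_lim) (hU_lim.congr' ?_)
    filter_upwards [hU_mem] with x' h0 using (ha_sum x' h0).symm
  have hz_lt : ∑ j, F j (z j) < y :=
    ((hG x hx).2 ⟨z, hz.1, hz_sum, rfl⟩).trans_lt hy
  have hz_within : Filter.Tendsto a (U : Filter (Fin N → ℝ))
      (nhdsWithin z {xs | ∀ j, 0 ≤ xs j}) :=
    tendsto_nhdsWithin_iff.mpr ⟨hz_lim, hU_mem.mono ha_nonneg⟩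
  have hev : ∀ᶠ x' in (U : Filter (Fin N → ℝ)), ∑ j, F j (a x' j) < y :=
    hz_within.eventually (hsum z hz.1 y hz_lt)
  obtain ⟨x', h0, hlt, hge⟩ := (hU_mem.and (hev.and hUy)).exists
  exact hge (ha_val x' h0 ▸ hlt)
end

section
/- Let F_1, ..., F_J be production functions on ℝ_+^N, each homogeneous of degree 1, and F = ⊕_{j=1}^J F_j their aggregate production function. Let w ∈ ℝ^N and suppose x* maximizes F(x) − w·x over x ∈ ℝ_+^N. Let x_1*, ..., x_J* ∈ ℝ_+^N satisfy x* = Σ_{j=1}^J x_j* and F(x*) = Σ_{j=1}^J F_j(x_j*), and let C = cone({x_1*, ..., x_J*}) be the smallest convex cone containing {x_1*, ..., x_J*}. Then F(x) = w·x for all x ∈ C. -/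
/-- `C` is the smallest convex cone containing `S`. -/
def IsSmallestConvexCone {N : ℕ} (S C : Set (Fin N → ℝ)) : Prop :=
  Convex ℝ C ∧ (∀ y ∈ C, ∀ α : ℝ, 0 ≤ α → α • y ∈ C) ∧ S ⊆ C ∧
    ∀ D : Set (Fin N → ℝ), Convex ℝ D → (∀ y ∈ D, ∀ α : ℝ, 0 ≤ α → α • y ∈ D) →
      S ⊆ D → C ⊆ D

/-- An element of the smallest convex cone containing a finite family is a combination of the
family with nonnegative coefficients. -/
theorem IsSmallestConvexCone.exists_eq_sum_smul {N J : ℕ} {xs : Fin J → (Fin N → ℝ)}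
    {C : Set (Fin N → ℝ)} (hC : IsSmallestConvexCone (Set.range xs) C)
    {x : Fin N → ℝ} (hx : x ∈ C) :
    ∃ a : Fin J → ℝ, (∀ j, 0 ≤ a j) ∧ x = ∑ j, a j • xs j := by
  refine hC.2.2.2 {x | ∃ a : Fin J → ℝ, (∀ j, 0 ≤ a j) ∧ x = ∑ j, a j • xs j} ?_ ?_ ?_ hx
  · rintro _ ⟨a, ha, rfl⟩ _ ⟨b, hb, rfl⟩ s t hs ht -
    refine ⟨fun j => s * a j + t * b j,
      fun j => add_nonneg (mul_nonneg hs (ha j)) (mul_nonneg ht (hb j)), ?_⟩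
    simp only [Finset.smul_sum, ← Finset.sum_add_distrib, add_smul, mul_smul]
  · rintro _ ⟨a, ha, rfl⟩ c hc
    refine ⟨fun j => c * a j, fun j => mul_nonneg hc (ha j), ?_⟩
    simp only [Finset.smul_sum, mul_smul]
  · rintro _ ⟨j, rfl⟩
    have hsingle : (0 : Fin J → ℝ) ≤ Pi.single j 1 := Pi.single_nonneg.2 zero_le_one
    refine ⟨Pi.single j 1, hsingle, ?_⟩
    simp [Pi.single_apply]

/-- Each nonnegative production function is dominated by the aggregate. -/
theorem IsAggregate.apply_le {N J : ℕ} {F : Fin J → (Fin N → ℝ) → ℝ} {G : (Fin N → ℝ) → ℝ}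
    (hG : IsAggregate F G) (hF : ∀ j, ∀ x : Fin N → ℝ, 0 ≤ x → 0 ≤ F j x)
    (j : Fin J) {y : Fin N → ℝ} (hy : 0 ≤ y) :
    F j y ≤ G y := by
  have hsingle : (0 : Fin J → Fin N → ℝ) ≤ Pi.single j y := Pi.single_nonneg.2 hy
  calc F j y = F j ((Pi.single j y : Fin J → Fin N → ℝ) j) := by rw [Pi.single_eq_same]
    _ ≤ ∑ k, F k ((Pi.single j y : Fin J → Fin N → ℝ) k) :=
      Finset.single_le_sum (f := fun k => F k ((Pi.single j y : Fin J → Fin N → ℝ) k))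
        (fun k _ => hF k _ (hsingle k)) (Finset.mem_univ j)
    _ ≤ G y := (hG y hy).2 ⟨Pi.single j y, hsingle, by simp, rfl⟩

/-- Linearity of the aggregate production function, profit maximization:
if `x*` maximizes `G x − w·x` over `x ≥ 0`, `x* = ∑ⱼ xⱼ*` with
`G x* = ∑ⱼ F j (xⱼ*)`, and `C` is the smallest convex cone containing
`{x 1*, …, x J*}`, then `G x = w·x` on `C`. -/
theorem aggregate_linear_profit_maximization
    {N J : ℕ} (F : Fin J → (Fin N → ℝ) → ℝ)
    (hF_nonneg : ∀ j, ∀ x : Fin N → ℝ, 0 ≤ x → 0 ≤ F j x)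
    (hF_usc : ∀ j, UpperSemicontinuousOn (F j) {x : Fin N → ℝ | 0 ≤ x})
    (hF_hom : ∀ j, ∀ c : ℝ, 0 ≤ c → ∀ x : Fin N → ℝ, 0 ≤ x → F j (c • x) = c * F j x)
    (G : (Fin N → ℝ) → ℝ) (hG : IsAggregate F G)
    (w : Fin N → ℝ) (xstar : Fin N → ℝ) (hxstar : 0 ≤ xstar)
    (hmax : ∀ x : Fin N → ℝ, 0 ≤ x →
      G x - ∑ i, w i * x i ≤ G xstar - ∑ i, w i * xstar i)
    (xs : Fin J → (Fin N → ℝ)) (hxs_nonneg : ∀ j, 0 ≤ xs j)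
    (hxs_sum : (∑ j, xs j) = xstar) (hxs_opt : G xstar = ∑ j, F j (xs j))
    (C : Set (Fin N → ℝ)) (hC : IsSmallestConvexCone (Set.range xs) C) :
    ∀ x ∈ C, G x = ∑ i, w i * x i := by
  change ∀ x : Fin N → ℝ, 0 ≤ x → G x - w ⬝ᵥ x ≤ G xstar - w ⬝ᵥ xstar at hmax
  change ∀ x ∈ C, G x = w ⬝ᵥ x
  have hF_le : ∀ j, ∀ y : Fin N → ℝ, 0 ≤ y → F j y ≤ w ⬝ᵥ y := by
    intro j y hy
    by_contra! hlt
    obtain ⟨n, hn⟩ := exists_nat_gt ((G xstar - w ⬝ᵥ xstar) / (F j y - w ⬝ᵥ y))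
    rw [div_lt_iff₀ (sub_pos.2 hlt)] at hn
    have hny : 0 ≤ (n : ℝ) • y := smul_nonneg n.cast_nonneg hy
    have hle := hG.apply_le hF_nonneg j hny
    have hbound := hmax _ hny
    rw [hF_hom j _ n.cast_nonneg y hy] at hle
    rw [dotProduct_smul, smul_eq_mul] at hbound
    linarith
  have hG_le : ∀ x : Fin N → ℝ, 0 ≤ x → G x ≤ w ⬝ᵥ x := by
    intro x hx
    obtain ⟨ys, hys, rfl, hval⟩ := (hG x hx).1
    rw [hval, dotProduct_sum]
    exact Finset.sum_le_sum fun j _ => hF_le j _ (hys j)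
  have hG_zero : 0 ≤ G 0 := by
    obtain ⟨ys, hys, -, hval⟩ := (hG 0 le_rfl).1
    rw [hval]
    exact Finset.sum_nonneg fun j _ => hF_nonneg j _ (hys j)
  have hprofit : ∑ j, F j (xs j) = ∑ j, w ⬝ᵥ xs j := by
    have hzero := hmax 0 le_rfl
    have hstar := hG_le xstar hxstar
    rw [dotProduct_zero] at hzero
    rw [← hxs_opt, ← dotProduct_sum, hxs_sum]
    linarith
  have hF_eq : ∀ j, F j (xs j) = w ⬝ᵥ xs j := fun j =>
    (Finset.sum_eq_sum_iff_of_le fun j _ => hF_le j _ (hxs_nonneg j)).1 hprofit j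
      (Finset.mem_univ j)
  intro x hx
  obtain ⟨a, ha, rfl⟩ := hC.exists_eq_sum_smul hx
  have hterm : ∀ j, 0 ≤ a j • xs j := fun j => smul_nonneg (ha j) (hxs_nonneg j)
  have hsum : 0 ≤ ∑ j, a j • xs j := Finset.sum_nonneg fun j _ => hterm j
  refine le_antisymm (hG_le _ hsum) ?_
  refine le_of_eq_of_le ?_ ((hG _ hsum).2 ⟨fun j => a j • xs j, hterm, rfl, rfl⟩)
  simp only [dotProduct_sum, dotProduct_smul, smul_eq_mul, hF_hom _ _ (ha _) _ (hxs_nonneg _),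
    hF_eq]
end

section
/- Let F_1, ..., F_J be production functions on ℝ_+^N, each concave and homogeneous of degree 1, and let F = ⊕_{j=1}^J F_j be their aggregate production function. Then the hypograph of the restriction of F to the unit simplex Δ_N equals the convex hull of the union of the hypographs of the restrictions of F_1, ..., F_J to Δ_N; that is, hyp F|_Δ = conv( ∪_{j=1}^J hyp F_j|_Δ ), where hyp f = { (x, y) : x ∈ Δ_N, y ≤ f(x) }. -/
/-- The hypograph of the restriction of `f` to the unit simplex `Δ_N`. -/
def hypOnSimplex {N : ℕ} (f : (Fin N → ℝ) → ℝ) : Set ((Fin N → ℝ) × ℝ) :=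
  {p : (Fin N → ℝ) × ℝ | p.1 ∈ stdSimplex ℝ (Fin N) ∧ p.2 ≤ f p.1}

section Aggregate

variable {N J : ℕ} {F : Fin J → (Fin N → ℝ) → ℝ} {G : (Fin N → ℝ) → ℝ}

theorem IsAggregate.concaveOn (hG : IsAggregate F G)
    (hF : ∀ j, ConcaveOn ℝ {x : Fin N → ℝ | 0 ≤ x} (F j)) :
    ConcaveOn ℝ {x : Fin N → ℝ | 0 ≤ x} G := by
  refine ⟨convex_Ici (0 : Fin N → ℝ), fun x hx y hy a b ha hb hab => ?_⟩
  obtain ⟨xs, hxs, hxsum, hGx⟩ := (hG x hx).1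
  obtain ⟨ys, hys, hysum, hGy⟩ := (hG y hy).1
  calc a • G x + b • G y = ∑ j, (a • F j (xs j) + b • F j (ys j)) := by
        rw [hGx, hGy, Finset.sum_add_distrib, Finset.smul_sum, Finset.smul_sum]
    _ ≤ ∑ j, F j (a • xs j + b • ys j) :=
        Finset.sum_le_sum fun j _ => (hF j).2 (hxs j) (hys j) ha hb hab
    _ ≤ G (a • x + b • y) := by
        refine (hG _ (convex_Ici (0 : Fin N → ℝ) hx hy ha hb hab)).2
          ⟨fun j => a • xs j + b • ys j, fun j => ?_, ?_, rfl⟩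
        · exact add_nonneg (smul_nonneg ha (hxs j)) (smul_nonneg hb (hys j))
        · rw [Finset.sum_add_distrib, ← Finset.smul_sum, ← Finset.smul_sum, hxsum, hysum]

theorem IsAggregate.le (hG : IsAggregate F G) (hF : ∀ j, F j 0 = 0) (j : Fin J)
    {x : Fin N → ℝ} (hx : 0 ≤ x) : F j x ≤ G x := by
  refine (hG x hx).2 ⟨Pi.single j x, fun k => ?_, ?_, ?_⟩
  · exact (Pi.single_nonneg (i := j).2 hx : (0 : Fin J → Fin N → ℝ) ≤ Pi.single j x) k
  · simp
  · rw [Finset.sum_eq_single j]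
    · simp
    · intro k _ hk
      rw [Pi.single_eq_of_ne hk, hF]
    · simp

theorem convex_hypOnSimplex {f : (Fin N → ℝ) → ℝ}
    (hf : ConcaveOn ℝ {x : Fin N → ℝ | 0 ≤ x} f) : Convex ℝ (hypOnSimplex f) :=
  (hf.subset (fun _ hx => hx.1) (convex_stdSimplex ℝ (Fin N))).convex_hypograph

theorem IsAggregate.hypOnSimplex_subset_convexHull (hG : IsAggregate F G)
    (hF_hom : ∀ j, ∀ c : ℝ, 0 ≤ c → ∀ x : Fin N → ℝ, 0 ≤ x → F j (c • x) = c * F j x) :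
    hypOnSimplex G ⊆ convexHull ℝ (⋃ j, hypOnSimplex (F j)) := by
  rintro ⟨x, y⟩ ⟨⟨hx, hx1⟩, hy⟩
  dsimp only at hx hx1 hy
  obtain ⟨xs, hxs, hxsum, hGx⟩ := (hG x hx).1
  set w : Fin J → ℝ := fun j => ∑ i, xs j i with hw
  have hw0 : ∀ j, 0 ≤ w j := fun j => Finset.sum_nonneg fun i _ => hxs j i
  have hw1 : ∑ j, w j = 1 := by
    rw [hw, Finset.sum_comm, ← hx1, ← hxsum]
    simp
  have hscale : ∀ j, w j • (w j)⁻¹ • xs j = xs j := by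
    intro j
    by_cases h : w j = 0
    · have hzero : xs j = 0 := funext fun i =>
        (Finset.sum_eq_zero_iff_of_nonneg fun i _ => hxs j i).1 h i (Finset.mem_univ i)
      rw [hzero, smul_zero, smul_zero]
    · exact smul_inv_smul₀ h _
  have hinv : ∀ j, 0 ≤ (w j)⁻¹ • xs j := fun j =>
    smul_nonneg (inv_nonneg.2 (hw0 j)) (hxs j)
  have key := (convex_convexHull ℝ (⋃ j, hypOnSimplex (F j))).finsum_mem
    (w := w) (z := fun j => ((w j)⁻¹ • xs j, F j ((w j)⁻¹ • xs j) - (G x - y))) hw0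
    (by rw [finsum_eq_sum_of_fintype, hw1]) (fun j hj => subset_convexHull ℝ _ <|
      Set.mem_iUnion.2 ⟨j, ⟨hinv j, ?_⟩, ?_⟩)
  · rw [finsum_eq_sum_of_fintype] at key
    convert key
    · simp only [Prod.fst_sum, Prod.smul_fst, hscale, hxsum]
    · simp only [Prod.snd_sum, Prod.smul_snd, smul_eq_mul, mul_sub, Finset.sum_sub_distrib,
        ← Finset.sum_mul, hw1, ← hF_hom _ _ (hw0 _) _ (hinv _), hscale, ← hGx]
      ring
  · simp only [Pi.smul_apply, smul_eq_mul, ← Finset.mul_sum]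
    exact inv_mul_cancel₀ hj
  · exact sub_le_self _ (sub_nonneg.2 hy)

end Aggregate

/-- Geometric characterization of the aggregate production function:
for concave homogeneous production functions `F 1, …, F J`, the hypograph of the
restriction of the aggregate production function `G` to the unit simplex equals the
convex hull of the union of the hypographs of the restrictions of the `F j`. -/
theorem aggregate_hypograph_eq_convexHull
    {N J : ℕ} (F : Fin J → (Fin N → ℝ) → ℝ)
    (hF_nonneg : ∀ j, ∀ x : Fin N → ℝ, 0 ≤ x → 0 ≤ F j x)
    (hF_usc : ∀ j, UpperSemicontinuousOn (F j) {x : Fin N → ℝ | 0 ≤ x})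
    (hF_concave : ∀ j, ConcaveOn ℝ {x : Fin N → ℝ | 0 ≤ x} (F j))
    (hF_hom : ∀ j, ∀ c : ℝ, 0 ≤ c → ∀ x : Fin N → ℝ, 0 ≤ x → F j (c • x) = c * F j x)
    (G : (Fin N → ℝ) → ℝ) (hG : IsAggregate F G) :
    hypOnSimplex G = convexHull ℝ (⋃ j, hypOnSimplex (F j)) := by
  refine (hG.hypOnSimplex_subset_convexHull hF_hom).antisymm
    (convexHull_min (Set.iUnion_subset fun j p hp => ⟨hp.1, hp.2.trans ?_⟩)
      (convex_hypOnSimplex (hG.concaveOn hF_concave)))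
  refine hG.le (fun k => ?_) j hp.1.1
  simpa using hF_hom k 0 le_rfl 0 le_rfl
end

section
/- Let F_1, ..., F_J be production functions on ℝ_+^N, each concave and homogeneous of degree 1, let F = ⊕_{j=1}^J F_j be their aggregate production function, and let x ∈ ℝ_+^N. Then there exist x_1, ..., x_J ∈ ℝ_+^N with Σ_{j=1}^J x_j = x and F(x) = Σ_{j=1}^J F_j(x_j) such that x_j ≠ 0 for at most N indices j. -/
/-- More than `N` nonzero vectors of the nonnegative orthant of `ℝ^N` satisfy a linear relation
with a negative coefficient, whose pairing with a given weight `v` is nonnegative. -/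
theorem exists_relation_of_card_lt {ι : Type*} [Fintype ι] {N : ℕ} (xs : ι → (Fin N → ℝ))
    (hxs : ∀ j, 0 ≤ xs j) (v : ι → ℝ) (hN : N < Set.ncard {j | xs j ≠ 0}) :
    ∃ t : ι → ℝ, (∀ j, xs j = 0 → t j = 0) ∧ ∑ j, t j • xs j = 0 ∧ 0 ≤ ∑ j, t j * v j ∧
      ∃ j, t j < 0 := by
  classical
  obtain ⟨t, hsupp, hrel, i, hi⟩ : ∃ t : ι → ℝ, (∀ j, xs j = 0 → t j = 0) ∧
      ∑ j, t j • xs j = 0 ∧ ∃ i, t i ≠ 0 := by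
    have hdep : ¬ LinearIndependent ℝ (fun j : {j | xs j ≠ 0} => xs j) := by
      intro h
      have hcard := h.fintype_card_le_finrank
      rw [Module.finrank_fin_fun, ← Nat.card_eq_fintype_card, Nat.card_coe_set_eq] at hcard
      omega
    obtain ⟨g, hg, i, hi⟩ := Fintype.not_linearIndependent_iff.1 hdep
    refine ⟨fun j => if h : xs j ≠ 0 then g ⟨j, h⟩ else 0, fun j hj => by simp [hj], ?_, i, ?_⟩
    · refine Eq.trans (Eq.symm ?_) hg
      refine Finset.sum_of_injOn Subtype.val Subtype.val_injective.injOn (by simp) ?_ ?_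
      · intro j _ hj
        have : xs j = 0 := by simpa using hj
        simp [this]
      · intro j _
        have : xs j ≠ 0 := j.2
        simp [this]
    · have : xs i ≠ 0 := i.2
      simpa [this] using hi
  have hneg : ∀ s : ι → ℝ, (∀ j, xs j = 0 → s j = 0) → ∑ j, s j • xs j = 0 → s i ≠ 0 →
      ∃ j, s j < 0 := by
    intro s hs hsum hsi
    by_contra! hpos
    have hzero := (Finset.sum_eq_zero_iff_of_nonneg
      fun j _ => smul_nonneg (hpos j) (hxs j)).1 hsum i (Finset.mem_univ i)
    rcases smul_eq_zero.1 hzero with h | h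
    · exact hsi h
    · exact hsi (hs i h)
  rcases le_total 0 (∑ j, t j * v j) with h | h
  · exact ⟨t, hsupp, hrel, h, hneg t hsupp hrel hi⟩
  · have hsupp' : ∀ j, xs j = 0 → (-t) j = 0 := fun j hj => by simp [hsupp j hj]
    have hrel' : ∑ j, (-t) j • xs j = 0 := by simp [hrel]
    exact ⟨-t, hsupp', hrel', by simpa using h, hneg (-t) hsupp' hrel' (by simpa using hi)⟩

/-- If more than `N` firms are active, some firm can be shut down by rescaling the inputs of the
others, without lowering total output. -/
theorem exists_allocation_ncard_lt {ι : Type*} [Fintype ι] {N : ℕ} (F : ι → (Fin N → ℝ) → ℝ)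
    (hF_hom : ∀ j, ∀ c : ℝ, 0 ≤ c → ∀ x : Fin N → ℝ, 0 ≤ x → F j (c • x) = c * F j x)
    (xs : ι → (Fin N → ℝ)) (hxs : ∀ j, 0 ≤ xs j) (hN : N < Set.ncard {j | xs j ≠ 0}) :
    ∃ ys : ι → (Fin N → ℝ), (∀ j, 0 ≤ ys j) ∧ ∑ j, ys j = ∑ j, xs j ∧
      ∑ j, F j (xs j) ≤ ∑ j, F j (ys j) ∧
      Set.ncard {j | ys j ≠ 0} < Set.ncard {j | xs j ≠ 0} := by
  obtain ⟨t, hsupp, hrel, hval, i, hi⟩ :=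
    exists_relation_of_card_lt xs hxs (fun j => F j (xs j)) hN
  obtain ⟨k, -, hk⟩ := Finset.exists_min_image Finset.univ t ⟨i, Finset.mem_univ i⟩
  have hk_neg : t k < 0 := (hk i (Finset.mem_univ i)).trans_lt hi
  set ε : ℝ := -(t k)⁻¹ with hε
  have hε_pos : 0 < ε := neg_pos.2 (inv_lt_zero.2 hk_neg)
  have hεk : ε * t k = -1 := by rw [hε, neg_mul, inv_mul_cancel₀ hk_neg.ne]
  have hc : ∀ j, 0 ≤ 1 + ε * t j := fun j => by
    have := mul_le_mul_of_nonneg_left (hk j (Finset.mem_univ j)) hε_pos.le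
    linarith
  refine ⟨fun j => (1 + ε * t j) • xs j, fun j => smul_nonneg (hc j) (hxs j), ?_, ?_, ?_⟩
  · simp_rw [add_smul, one_smul, mul_smul, Finset.sum_add_distrib, ← Finset.smul_sum, hrel,
      smul_zero, add_zero]
  · simp_rw [fun j => hF_hom j _ (hc j) _ (hxs j), add_mul, one_mul, mul_assoc,
      Finset.sum_add_distrib, ← Finset.mul_sum]
    exact le_add_of_nonneg_right (mul_nonneg hε_pos.le hval)
  · refine Set.ncard_lt_ncard ?_ (Set.toFinite _)
    have hsub : {j | (1 + ε * t j) • xs j ≠ 0} ⊆ {j | xs j ≠ 0} :=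
      fun j hj h => hj (by simp [h])
    refine (Set.ssubset_iff_of_subset hsub).2 ⟨k, ?_, ?_⟩
    · exact fun h => hk_neg.ne (hsupp k h)
    · simp [hεk]

/-- with `N` inputs and concave homogeneous production functions, the
aggregate output at any `x ≥ 0` can be achieved by operating at most `N` firms: there is
an optimal allocation `(xs j)` with `xs j ≠ 0` for at most `N` indices `j`. -/
theorem aggregate_attained_by_at_most_N_firms
    {N J : ℕ} (F : Fin J → (Fin N → ℝ) → ℝ)
    (hF_nonneg : ∀ j, ∀ x : Fin N → ℝ, 0 ≤ x → 0 ≤ F j x)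
    (hF_usc : ∀ j, UpperSemicontinuousOn (F j) {x : Fin N → ℝ | 0 ≤ x})
    (hF_concave : ∀ j, ConcaveOn ℝ {x : Fin N → ℝ | 0 ≤ x} (F j))
    (hF_hom : ∀ j, ∀ c : ℝ, 0 ≤ c → ∀ x : Fin N → ℝ, 0 ≤ x → F j (c • x) = c * F j x)
    (G : (Fin N → ℝ) → ℝ) (hG : IsAggregate F G)
    (x : Fin N → ℝ) (hx : 0 ≤ x) :
    ∃ xs : Fin J → (Fin N → ℝ),
      (∀ j, 0 ≤ xs j) ∧ (∑ j, xs j) = x ∧ G x = (∑ j, F j (xs j)) ∧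
        Set.ncard {j : Fin J | xs j ≠ 0} ≤ N := by
  obtain ⟨⟨xs, hxs, hsum, hval⟩, hmax⟩ := hG x hx
  induction hn : Set.ncard {j | xs j ≠ 0} using Nat.strong_induction_on generalizing xs with
  | _ n ih =>
    by_cases hN : Set.ncard {j | xs j ≠ 0} ≤ N
    · exact ⟨xs, hxs, hsum, hval, hN⟩
    · obtain ⟨ys, hys, hys_sum, hle, hlt⟩ :=
        exists_allocation_ncard_lt F hF_hom xs hxs (not_le.1 hN)
      rw [hsum] at hys_sum
      exact ih _ (hn ▸ hlt) ys hys hys_sum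
        ((hval.trans_le hle).antisymm (hmax ⟨ys, hys, hys_sum, rfl⟩)) rfl
end
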